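/- arXiv:2307.11483 — 10 statements merged into one kernel-verified Lean document; each statement's English description precedes it below -/
import Mathlib

section
/- For every n ≥ 1, the Büchi language of the NBA G_n equals L_n^ω: an ω-word α : ℕ → Fin 3 admits an accepting run of G_n if and only if α ∈ L_n^ω. -/
/-- A run of a nondeterministic Büchi automaton with transition function `δ` on the
ω-word `α`, starting from state `q`. -/
def NBARun {Q : Type} (δ : Q → Fin 3 → Set Q) (q : Q) (α : ℕ → Fin 3) (r : ℕ → Q) : Prop :=
  r 0 = q ∧ ∀ i, r (i + 1) ∈ δ (r i) (α i)

/-- The transition function of the NBA `G_n`: states are `Fin (n + 2)`, where `⟨i, _⟩`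
for `i ≤ n` is the state `q_i` and `⟨n + 1, _⟩` is the accepting state `f`.
Letter `2 : Fin 3` plays the role of the end-marker `$`. -/
def gnδ (n : ℕ) (q : Fin (n + 2)) (a : Fin 3) : Set (Fin (n + 2)) :=
  if h0 : q.val = 0 then
    (if a.val = 1 then {⟨0, by omega⟩, ⟨1, by omega⟩} else {⟨0, by omega⟩})
  else if hf : q.val = n + 1 then {⟨0, by omega⟩}
  else if hqn : q.val = n then
    (if a.val = 2 then {⟨n + 1, by omega⟩} else {⟨0, by omega⟩})
  else
    (if a.val = 2 then {⟨0, by omega⟩}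
     else {⟨q.val + 1, by have := q.isLt; omega⟩})

/-- `LnOmega n` is the ω-language `L_n^ω`: ω-words containing infinitely many factors
from `1·{0,1}^{n-1}·2`, i.e. infinitely many factors from `L_n`. -/
def LnOmega (n : ℕ) : Set (ℕ → Fin 3) :=
  {α | {i : ℕ | α i = 1 ∧ (∀ k, 1 ≤ k → k < n → α (i + k) ≠ 2) ∧ α (i + n) = 2}.Infinite}

theorem mem_gn (n : ℕ) (hn : 1 ≤ n) (q p : Fin (n + 2)) (a : Fin 3) :
    p ∈ gnδ n q a ↔
      ((q.val = 0 ∧ (p.val = 0 ∨ (a = 1 ∧ p.val = 1))) ∨ (q.val = n + 1 ∧ p.val = 0) ∨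
       (q.val = n ∧ a = 2 ∧ p.val = n + 1) ∨ (q.val = n ∧ a ≠ 2 ∧ p.val = 0) ∨
       (1 ≤ q.val ∧ q.val < n ∧ a = 2 ∧ p.val = 0) ∨
       (1 ≤ q.val ∧ q.val < n ∧ a ≠ 2 ∧ p.val = q.val + 1)) := by
  have hq := q.isLt
  have h1 : a = 1 ↔ a.val = 1 := by rw [Fin.ext_iff]; rfl
  have h2 : a = 2 ↔ a.val = 2 := by rw [Fin.ext_iff]; rfl
  rw [ne_eq, h1, h2]
  unfold gnδ
  split_ifs <;> simp only [Set.mem_insert_iff, Set.mem_singleton_iff, Fin.ext_iff] <;> omega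

/-- Start positions of factors. -/
def SS (n : ℕ) (α : ℕ → Fin 3) : Set ℕ :=
  {i : ℕ | α i = 1 ∧ (∀ k, 1 ≤ k → k < n → α (i + k) ≠ 2) ∧ α (i + n) = 2}

theorem fwd (n : ℕ) (hn : 1 ≤ n) (α : ℕ → Fin 3) (r : ℕ → Fin (n + 2)) (h0 : (r 0).val = 0)
    (hr : ∀ i, r (i + 1) ∈ gnδ n (r i) (α i)) :
    ∀ t v, (r t).val = v + 1 → v + 1 ≤ n →
      ∃ s, t = s + v + 1 ∧ α s = 1 ∧ ∀ k, 1 ≤ k → k < v + 1 → α (s + k) ≠ 2 := by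
  intro t
  induction t with
  | zero => intro v hv; omega
  | succ t ih =>
    intro v hv hvn
    have h := (mem_gn n hn _ _ _).1 (hr t)
    rcases h with ⟨h, h' | ⟨h', h''⟩⟩ | h | h | h | h | ⟨h, h', h2, h3⟩
    · omega
    · exact ⟨t, by omega, h', fun k _ _ => by omega⟩
    · omega
    · omega
    · omega
    · omega
    · obtain ⟨s, e, hs, hk⟩ := ih (v - 1) (by omega) (by omega)
      refine ⟨s, by omega, hs, fun k k1 k2 => ?_⟩
      by_cases hkv : k = v
      · have : s + k = t := by omega
        rw [this]; exact h2
      · exact hk k k1 (by omega)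

open Classical in
/-- Deterministic strategy. -/
noncomputable def nxt (n : ℕ) (α : ℕ → Fin 3) : ℕ → ℕ
  | 0 => 0
  | t + 1 =>
    let s := nxt n α t
    if s = 0 then (if t ∈ SS n α then 1 else 0)
    else if s = n + 1 then 0
    else if α t = 2 then (if s = n then n + 1 else 0)
    else if s = n then 0 else s + 1

theorem nxt_lt (n : ℕ) (α : ℕ → Fin 3) (t : ℕ) : nxt n α t < n + 2 := by
  induction t with
  | zero => simp [nxt]
  | succ t ih => simp only [nxt]; split_ifs <;> omega

theorem nxt_zero (n : ℕ) (α : ℕ → Fin 3) (d : ℕ) :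
    ∀ t, n + 2 ≤ nxt n α t + d → ∃ u, t ≤ u ∧ nxt n α u = 0 := by
  induction d with
  | zero => intro t h; have := nxt_lt n α t; omega
  | succ d ih =>
    intro t h
    by_cases h0 : nxt n α t = 0
    · exact ⟨t, le_rfl, h0⟩
    by_cases h1 : nxt n α (t + 1) = 0
    · exact ⟨t + 1, by omega, h1⟩
    have : nxt n α (t + 1) = nxt n α t + 1 := by
      revert h1
      simp only [nxt]
      split_ifs <;> omega
    obtain ⟨u, hu, hu'⟩ := ih (t + 1) (by omega)
    exact ⟨u, by omega, hu'⟩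

theorem nxt_run (n : ℕ) (hn : 1 ≤ n) (α : ℕ → Fin 3) (t : ℕ) (h0 : nxt n α t = 0)
    (ht : t ∈ SS n α) : nxt n α (t + n + 1) = n + 1 := by
  have key : ∀ v, v < n → nxt n α (t + v + 1) = v + 1 := by
    intro v
    induction v with
    | zero => intro _; simp [nxt, h0, ht]
    | succ v ih =>
      intro hv
      have h := ih (by omega)
      have h2 : α (t + (v + 1)) ≠ 2 := ht.2.1 (v + 1) (by omega) hv
      have e : nxt n α (t + (v + 1)) = v + 1 := h
      have e2 : v + 1 ≠ n + 1 := by omega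
      have e3 : v + 1 ≠ n := by omega
      rw [nxt]
      simp only [e, if_neg h2, if_neg e2, if_neg e3, if_neg (Nat.succ_ne_zero v)]
  have h := key (n - 1) (by omega)
  have e : nxt n α (t + n) = n := by
    rw [show t + n = t + (n - 1) + 1 by omega, h]; omega
  rw [nxt]
  simp only [e, ht.2.2, if_true]
  split_ifs <;> omega

theorem nxt_reach (n : ℕ) (hn : 1 ≤ n) (α : ℕ → Fin 3) (d : ℕ) :
    ∀ t, nxt n α t = 0 → t + d ∈ SS n α → ∃ u, t < u ∧ nxt n α u = n + 1 := by
  induction d with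
  | zero => intro t h h'; exact ⟨t + n + 1, by omega, nxt_run n hn α t h h'⟩
  | succ d ih =>
    intro t h h'
    by_cases hs : t ∈ SS n α
    · exact ⟨t + n + 1, by omega, nxt_run n hn α t h hs⟩
    · obtain ⟨u, hu, hu'⟩ := ih (t + 1) (by simp [nxt, h, hs])
        (by rwa [show t + 1 + d = t + (d + 1) by omega])
      exact ⟨u, by omega, hu'⟩

/-- For every `n ≥ 1`, the Büchi language of the NBA `G_n` (initial state `q_0`,
accepting set `{f}`) equals `L_n^ω`. -/
theorem stmt_2 (n : ℕ) (hn : 1 ≤ n) (α : ℕ → Fin 3) :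
    (∃ r : ℕ → Fin (n + 2), NBARun (gnδ n) ⟨0, by omega⟩ α r ∧
      {i : ℕ | r i ∈ ({⟨n + 1, by omega⟩} : Set (Fin (n + 2)))}.Infinite) ↔
    α ∈ LnOmega n := by
  constructor
  · rintro ⟨r, ⟨h0, hr⟩, hinf⟩
    change (SS n α).Infinite
    refine Set.infinite_of_forall_exists_gt fun N => ?_
    obtain ⟨t, ht, htN⟩ := hinf.exists_gt (N + n + 2)
    have hv : (r t).val = n + 1 := by
      have : r t = ⟨n + 1, by omega⟩ := ht
      rw [this]
    obtain ⟨t, rfl⟩ : ∃ t', t = t' + 1 := ⟨t - 1, by omega⟩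
    have h := (mem_gn n hn _ _ _).1 (hr t)
    have h' : (r t).val = n ∧ α t = 2 := by
      rcases h with ⟨h, h' | ⟨h', h''⟩⟩ | h | h | h | h | h
      · omega
      · omega
      · omega
      · exact ⟨h.1, h.2.1⟩
      · omega
      · omega
      · omega
    obtain ⟨s, e, hs, hk⟩ := fwd n hn α r (by rw [h0]) hr t (n - 1) (by omega) (by omega)
    refine ⟨s, ⟨hs, fun k k1 k2 => hk k k1 (by omega), ?_⟩, by omega⟩
    rw [show s + n = t by omega]; exact h'.2
  · intro h
    change (SS n α).Infinite at h
    refine ⟨fun t => ⟨nxt n α t, nxt_lt n α t⟩, ⟨by simp [nxt], fun t => ?_⟩, ?_⟩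
    · rw [mem_gn n hn]
      have hlt := nxt_lt n α t
      have hS : t ∈ SS n α → α t = 1 := fun h => h.1
      simp only [nxt]
      split_ifs with a b c d e f
      · exact Or.inl ⟨a, Or.inr ⟨hS b, rfl⟩⟩
      all_goals omega
    · refine Set.infinite_of_forall_exists_gt fun N => ?_
      obtain ⟨t, ht, ht0⟩ := nxt_zero n α (n + 2) N (by omega)
      obtain ⟨s, hs, hst⟩ := h.exists_gt t
      obtain ⟨u, hu, hu'⟩ := nxt_reach n hn α (s - t) t ht0
        (by rwa [show t + (s - t) = s by omega])
      exact ⟨u, Fin.ext hu', by omega⟩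
end

section
/- Let n ≥ 1 and let (Q, δ, q0, F) be a partial deterministic Büchi automaton over Fin 3 whose language equals L_n^ω and in which every state is reachable from q0. Then the automaton is complete: δ q σ ≠ none for every state q and every letter σ : Fin 3. -/
/-- The state (if any) reached by a partial deterministic automaton with transition
function `δ` from state `q` after reading the finite word `w`. -/
def pStar {Q : Type} (δ : Q → Fin 3 → Option Q) : Q → List (Fin 3) → Option Q
  | q, [] => some q
  | q, a :: w => (δ q a).bind fun q' => pStar δ q' w

theorem pStar_run {Q : Type} (δ : Q → Fin 3 → Option Q) (w : List (Fin 3)) :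
    ∀ (r : ℕ → Q) (α : ℕ → Fin 3), (∀ i, δ (r i) (α i) = some (r (i + 1))) →
      (∀ i (h : i < w.length), α i = w[i]) → pStar δ (r 0) w = some (r w.length) := by
  induction w with
  | nil => intro r α _ _; rfl
  | cons a w ih =>
    intro r α hr hα
    have h0 : α 0 = a := hα 0 (by simp)
    have h1 := hr 0
    rw [h0] at h1
    have h2 := ih (fun i => r (i + 1)) (fun i => α (i + 1)) (fun i => hr (i + 1))
      (fun i h => by
        have := hα (i + 1) (by simpa using h)
        simpa using this)
    simp only [pStar, h1, Option.bind_some, List.length_cons]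
    exact h2

/-- Let `n ≥ 1` and let `(Q, δ, q0, F)` be a partial deterministic Büchi automaton over
`Fin 3` whose language equals `L_n^ω` and in which every state is reachable from `q0`.
Then the automaton is complete: `δ q σ ≠ none` for all `q` and `σ`. -/
theorem stmt_4 (n : ℕ) (hn : 1 ≤ n) (Q : Type) [Fintype Q]
    (δ : Q → Fin 3 → Option Q) (q0 : Q) (F : Set Q)
    (hlang : {α : ℕ → Fin 3 | ∃ r : ℕ → Q, r 0 = q0 ∧
        (∀ i, δ (r i) (α i) = some (r (i + 1))) ∧ {i : ℕ | r i ∈ F}.Infinite}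
      = LnOmega n)
    (hreach : ∀ q : Q, ∃ w : List (Fin 3), pStar δ q0 w = some q) :
    ∀ (q : Q) (σ : Fin 3), δ q σ ≠ none := by
  intro q σ hnone
  obtain ⟨w, hw⟩ := hreach q
  let α : ℕ → Fin 3 := fun i =>
    if h : i < w.length then w[i] else if i = w.length then σ else
      if (i - (w.length + 1)) % (n + 1) = n then 2 else 1
  have hval : ∀ m k, k ≤ n → α (w.length + 1 + (n + 1) * m + k) = if k = n then 2 else 1 := by
    intro m k hk
    have h1 : ¬ (w.length + 1 + (n + 1) * m + k < w.length) := by omega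
    have h2 : ¬ (w.length + 1 + (n + 1) * m + k = w.length) := by omega
    have h3 : (w.length + 1 + (n + 1) * m + k - (w.length + 1)) = k + (n + 1) * m := by omega
    simp only [α, h1, h2, h3, dif_neg, if_neg, not_false_eq_true, Nat.add_mul_mod_self_left,
      Nat.mod_eq_of_lt (Nat.lt_succ_of_le hk)]
  have hmem : α ∈ LnOmega n := by
    refine Set.infinite_of_injective_forall_mem
      (f := fun m : ℕ => w.length + 1 + (n + 1) * m) ?_ ?_
    · intro a b hab
      have : (n + 1) * a = (n + 1) * b := by simpa using hab
      exact Nat.eq_of_mul_eq_mul_left (Nat.succ_pos n) this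
    · intro m
      refine ⟨?_, ?_, ?_⟩
      · have := hval m 0 (Nat.zero_le _)
        rw [if_neg (by omega)] at this
        exact this
      · intro k _ hk
        rw [hval m k hk.le, if_neg hk.ne]
        decide
      · rw [hval m n le_rfl, if_pos rfl]
  rw [← hlang] at hmem
  obtain ⟨r, hr0, hr, -⟩ := hmem
  have h := pStar_run δ w r α hr (fun i h => by simp [α, h])
  rw [hr0, hw] at h
  have hq : q = r w.length := Option.some.inj h
  have hs := hr w.length
  have hσ : α w.length = σ := by simp [α]
  rw [← hq, hσ, hnone] at hs
  cases hs
end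

section
/- For every n ≥ 1, the language of the NBA S_n equals L_n^s: an ω-word α : ℕ → Fin 3 admits a run of S_n from the initial state q_0 if and only if α ∈ L_n^s. (Since every state of S_n is accepting, every run is accepting.) -/
/-- The transition function of the safety NBA `S_n`: states are `Fin (n + 1)`, where
`⟨i, _⟩` is the state `q_i`. Letter `2 : Fin 3` plays the role of the end-marker `$`.
Transitions: `δ(q_0,0) = {q_0}`, `δ(q_0,1) = {q_0,q_1}`, `δ(q_i,σ) = {q_{i+1}}` for
`1 ≤ i ≤ n-1` and `σ ∈ {0,1}`, `δ(q_n,2) = {q_n}`, and `∅` in all remaining cases. -/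
def snδ (n : ℕ) (q : Fin (n + 1)) (a : Fin 3) : Set (Fin (n + 1)) :=
  if h0 : q.val = 0 then
    (if a.val = 0 then {⟨0, by omega⟩}
     else if a.val = 1 then {⟨0, by omega⟩, (1 : Fin (n + 1))}
     else ∅)
  else if hqn : q.val = n then
    (if a.val = 2 then {q} else ∅)
  else
    (if a.val = 2 then ∅ else {⟨q.val + 1, by have := q.isLt; omega⟩})

/-- `LnS n` is the ω-language `L_n^s = {w·$^ω | w ∈ L_n} ∪ {0,1}^ω` over `Fin 3`. -/
def LnS (n : ℕ) : Set (ℕ → Fin 3) :=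
  {α | (∀ i, α i ≠ 2) ∨
    ∃ m, n ≤ m ∧ (∀ j < m, α j ≠ 2) ∧ α (m - n) = 1 ∧ ∀ j, m ≤ j → α j = 2}

theorem snδ_mem (n : ℕ) (hn : 1 ≤ n) (q p : Fin (n + 1)) (a : Fin 3) :
    p ∈ snδ n q a ↔
      (q.val = 0 ∧ a.val ≠ 2 ∧ (p.val = 0 ∨ (a.val = 1 ∧ p.val = 1))) ∨
      (q.val ≠ 0 ∧ q.val = n ∧ a.val = 2 ∧ p.val = n) ∨
      (q.val ≠ 0 ∧ q.val < n ∧ a.val ≠ 2 ∧ p.val = q.val + 1) := by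
  have h1 : ((1 : Fin (n + 1)) : ℕ) = 1 := by
    rw [Fin.val_one']; exact Nat.mod_eq_of_lt (by omega)
  have hq := q.isLt
  have ha := a.isLt
  unfold snδ
  split_ifs <;>
    simp only [Set.mem_singleton_iff, Set.mem_insert_iff, Set.mem_empty_iff_false, Fin.ext_iff, h1, false_iff] <;>
    omega

/-- For every `n ≥ 1`, the language of the NBA `S_n` equals `L_n^s`: an ω-word admits a
run of `S_n` from the initial state `q_0` iff it belongs to `L_n^s`. (All states of
`S_n` are accepting, so every run is accepting.) -/
theorem stmt_12 (n : ℕ) (hn : 1 ≤ n) (α : ℕ → Fin 3) :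
    (∃ r : ℕ → Fin (n + 1), NBARun (snδ n) ⟨0, by omega⟩ α r) ↔ α ∈ LnS n := by
  have v1 : ∀ a : Fin 3, a = 1 ↔ a.val = 1 := by decide
  have v2 : ∀ a : Fin 3, a = 2 ↔ a.val = 2 := by decide
  simp only [NBARun, snδ_mem n hn, LnS, Set.mem_ofPred_eq, ne_eq, v1, v2]
  constructor
  · rintro ⟨r, h0, hr⟩
    have h0' : (r 0).val = 0 := by rw [h0]
    by_cases hz : ∀ i, (r i).val = 0
    · left
      intro i
      have := hr i
      have := hz i
      omega
    · right
      push Not at hz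
      classical
      obtain ⟨k, hk⟩ : ∃ k, Nat.find hz = k + 1 := by
        refine Nat.exists_eq_succ_of_ne_zero fun h => ?_
        have := Nat.find_spec hz
        rw [h] at this
        exact this h0'
      have hk1 : (r (k + 1)).val ≠ 0 := hk ▸ Nat.find_spec hz
      have hlt : ∀ j, j ≤ k → (r j).val = 0 := by
        intro j hj
        by_contra h
        exact Nat.find_min hz (by omega) h
      have hA : ∀ d, d < n → (r (k + 1 + d)).val = 1 + d := by
        intro d
        induction d with
        | zero =>
          intro _
          have := hr k
          have := hlt k le_rfl
          simp only [Nat.add_zero]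
          omega
        | succ d ih =>
          intro hd
          have := ih (by omega)
          have h := hr (k + 1 + d)
          rw [← Nat.add_assoc]
          omega
      have hB : ∀ e, (r (k + n + e)).val = n := by
        intro e
        induction e with
        | zero =>
          have := hA (n - 1) (by omega)
          rw [show k + 1 + (n - 1) = k + n + 0 by omega] at this
          omega
        | succ e ih =>
          have h := hr (k + n + e)
          rw [← Nat.add_assoc]
          omega
      refine ⟨k + n, by omega, ?_, ?_, ?_⟩
      · intro j hj
        have h := hr j
        by_cases hjk : j ≤ k
        · have := hlt j hjk
          omega
        · have h2 := hA (j - (k + 1)) (by omega)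
          rw [show k + 1 + (j - (k + 1)) = j by omega] at h2
          omega
      · rw [Nat.add_sub_cancel]
        have := hr k
        have := hlt k le_rfl
        omega
      · intro j hj
        have h := hr j
        have h2 := hB (j - (k + n))
        rw [show k + n + (j - (k + n)) = j by omega] at h2
        omega
  · rintro (h | ⟨m, hm, h1, h2, h3⟩)
    · exact ⟨fun _ => ⟨0, by omega⟩, rfl, fun i => Or.inl ⟨rfl, h i, Or.inl rfl⟩⟩
    · refine ⟨fun j => ⟨min n (j - (m - n)), by omega⟩, ?_, ?_⟩
      · simp
      · intro i
        have a1 := h1 i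
        have a3 := h3 i
        dsimp only
        rcases Nat.lt_trichotomy i (m - n) with hi | hi | hi
        · omega
        · rw [← hi] at h2
          omega
        · omega
end

section
/- For every n ≥ 1, the NBA S_n is strongly unambiguous: for every ω-word α : ℕ → Fin 3 and any two runs r, r' of S_n on α from the initial state q_0, one has r = r' (every ω-word has at most one run). -/
theorem sn_step (n : ℕ) (hn : 1 ≤ n) (q q' : Fin (n + 1)) (a : Fin 3) (h : q' ∈ snδ n q a) :
    (q.val = 0 ∧ a.val = 0 ∧ q'.val = 0) ∨ (q.val = 0 ∧ a.val = 1 ∧ (q'.val = 0 ∨ q'.val = 1)) ∨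
    (q.val ≠ 0 ∧ q.val = n ∧ a.val = 2 ∧ q'.val = n) ∨
    (q.val ≠ 0 ∧ q.val ≠ n ∧ a.val ≠ 2 ∧ q'.val = q.val + 1) := by
  have h1 : (1 : Fin (n + 1)).val = 1 := by
    rw [Fin.val_one']
    exact Nat.mod_eq_of_lt (by omega)
  unfold snδ at h
  split_ifs at h <;>
    simp only [Set.mem_singleton_iff, Set.mem_insert_iff, Set.mem_empty_iff_false,
      Fin.ext_iff, h1] at h <;> omega

theorem sn_reach (n : ℕ) (hn : 1 ≤ n) (α : ℕ → Fin 3) (r : ℕ → Fin (n + 1))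
    (h : ∀ i, r (i + 1) ∈ snδ n (r i) (α i)) (i : ℕ) (hi : (r i).val ≠ 0) :
    (r (i + n)).val = n := by
  have key : ∀ k, min n (1 + k) ≤ (r (i + k)).val := by
    intro k
    induction k with
    | zero => simp; omega
    | succ k ih =>
      have := sn_step n hn _ _ _ (h (i + k))
      rw [← add_assoc i k 1]
      omega
  have := key n
  have := (r (i + n)).isLt
  omega

theorem sn_aux (n : ℕ) (hn : 1 ≤ n) (α : ℕ → Fin 3) (r r' : ℕ → Fin (n + 1))
    (h : ∀ i, r (i + 1) ∈ snδ n (r i) (α i)) (h' : ∀ i, r' (i + 1) ∈ snδ n (r' i) (α i))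
    (i : ℕ) (hi : (r i).val ≠ 0) : (r i).val = (r' i).val := by
  have e1 := sn_reach n hn α r h i hi
  have s1 := sn_step n hn _ _ _ (h (i + n))
  have s2 := sn_step n hn _ _ _ (h' (i + n))
  have e2 := sn_reach n hn α r h (i + n) (by omega)
  have e3 := sn_reach n hn α r' h' (i + n) (by omega)
  have back : ∀ k, (r (i + k)).val = (r' (i + k)).val → (r i).val = (r' i).val := by
    intro k
    induction k with
    | zero => exact id
    | succ k ih =>
      intro hk
      apply ih
      have t1 := sn_step n hn _ _ _ (h (i + k))
      have t2 := sn_step n hn _ _ _ (h' (i + k))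
      rw [← add_assoc] at hk
      omega
  exact back (n + n) (by rw [← add_assoc]; omega)

/-- For every `n ≥ 1`, the NBA `S_n` is strongly unambiguous: every ω-word has at most
one run from the initial state `q_0`. -/
theorem stmt_13 (n : ℕ) (hn : 1 ≤ n) (α : ℕ → Fin 3) (r r' : ℕ → Fin (n + 1))
    (h : NBARun (snδ n) ⟨0, by omega⟩ α r) (h' : NBARun (snδ n) ⟨0, by omega⟩ α r') :
    r = r' := by
  funext i
  apply Fin.ext
  by_cases h1 : (r i).val = 0
  · by_cases h2 : (r' i).val = 0
    · omega
    · exact (sn_aux n hn α r' r h'.2 h.2 i h2).symm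
  · exact sn_aux n hn α r r' h.2 h'.2 i h1
end

section
/- For every n ≥ 1, the NBA S_n is separating: for any two distinct states q ≠ q' of S_n, the set of ω-words admitting a run of S_n from q and the set of ω-words admitting a run of S_n from q' are disjoint. (Since every state of S_n is accepting, a run from a state is automatically accepting.) -/
theorem sn_step_s14 (n : ℕ) (hn : 1 ≤ n) (p p' s s' : Fin (n + 1)) (a : Fin 3)
    (h : s ∈ snδ n p a) (h' : s' ∈ snδ n p' a) (hlt : p.val < p'.val) :
    s.val < s'.val ∧ s'.val = p'.val + 1 := by
  have h1 : (1 : Fin (n + 1)).val = 1 := by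
    rw [Fin.val_one']; exact Nat.mod_eq_of_lt (by omega)
  have hp := p'.isLt
  unfold snδ at h h'
  split_ifs at h h' <;>
    simp only [Set.mem_singleton_iff, Set.mem_insert_iff, Set.mem_empty_iff_false,
      Fin.ext_iff, h1] at h h' <;> omega

theorem sn_aux_s14 (n : ℕ) (hn : 1 ≤ n) (q q' : Fin (n + 1)) (hqq : q.val < q'.val)
    (α : ℕ → Fin 3) (r r' : ℕ → Fin (n + 1)) (h : NBARun (snδ n) q α r)
    (h' : NBARun (snδ n) q' α r') : False := by
  have key : ∀ i, (r i).val < (r' i).val ∧ (r' i).val = q'.val + i := by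
    intro i
    induction i with
    | zero => rw [h.1, h'.1]; exact ⟨hqq, rfl⟩
    | succ k ih =>
      have := sn_step_s14 n hn _ _ _ _ _ (h.2 k) (h'.2 k) ih.1
      omega
  have := (key (n + 1)).2
  have := (r' (n + 1)).isLt
  omega

/-- For every `n ≥ 1`, the NBA `S_n` is separating: for distinct states `q ≠ q'`, the set
of ω-words admitting a run of `S_n` from `q` and the set of ω-words admitting a run of
`S_n` from `q'` are disjoint. (All states of `S_n` are accepting, so runs are
automatically accepting.) -/
theorem stmt_14 (n : ℕ) (hn : 1 ≤ n) (q q' : Fin (n + 1)) (hqq : q ≠ q') :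
    Disjoint {α : ℕ → Fin 3 | ∃ r : ℕ → Fin (n + 1), NBARun (snδ n) q α r}
             {α : ℕ → Fin 3 | ∃ r : ℕ → Fin (n + 1), NBARun (snδ n) q' α r} := by
  rw [Set.disjoint_left]
  rintro α ⟨r, h⟩ ⟨r', h'⟩
  rcases Nat.lt_or_gt_of_ne (fun e => hqq (Fin.ext e)) with hl | hl
  · exact sn_aux_s14 n hn q q' hl α r r' h h'
  · exact sn_aux_s14 n hn q' q hl α r' r h' h
end

section
/- For every n ≥ 1, the Büchi language of the NBA R_n equals L_n^r: an ω-word α : ℕ → Fin 3 admits an accepting run of R_n from the initial state q_0 if and only if α ∈ L_n^r. -/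
/-- The transition function of the reachability NBA `R_n`: states are `Fin (n + 2)`, where
`⟨i, _⟩` for `i ≤ n` is the state `q_i` and `⟨n + 1, _⟩` is the accepting sink `f`.
Letter `2 : Fin 3` plays the role of the end-marker `$`. Transitions: `δ(q_0,0) = {q_0}`,
`δ(q_0,1) = {q_0,q_1}`, `δ(q_i,σ) = {q_{i+1}}` for `1 ≤ i ≤ n-1` and `σ ∈ {0,1}`,
`δ(q_n,2) = {f}`, `δ(f,σ) = {f}` for all `σ`, and `∅` in all remaining cases. -/
def rnδ (n : ℕ) (q : Fin (n + 2)) (a : Fin 3) : Set (Fin (n + 2)) :=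
  if h0 : q.val = 0 then
    (if a.val = 0 then {⟨0, by omega⟩}
     else if a.val = 1 then {⟨0, by omega⟩, (1 : Fin (n + 2))}
     else ∅)
  else if hf : q.val = n + 1 then {⟨n + 1, by omega⟩}
  else if hqn : q.val = n then
    (if a.val = 2 then {⟨n + 1, by omega⟩} else ∅)
  else
    (if a.val = 2 then ∅ else {⟨q.val + 1, by have := q.isLt; omega⟩})

/-- `LnR n` is the ω-language `L_n^r`: ω-words whose first occurrence of the letter `2`
is at some position `m ≥ n` and the letter `n` positions before it is `1`. -/
def LnR (n : ℕ) : Set (ℕ → Fin 3) :=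
  {α | ∃ m, n ≤ m ∧ α m = 2 ∧ (∀ j < m, α j ≠ 2) ∧ α (m - n) = 1}

lemma rn_mem (n : ℕ) (hn : 1 ≤ n) (q p : Fin (n + 2)) (a : Fin 3) :
    p ∈ rnδ n q a ↔
      (q.val = 0 ∧ a ≠ 2 ∧ (p.val = 0 ∨ (a = 1 ∧ p.val = 1))) ∨
      (q.val = n + 1 ∧ p.val = n + 1) ∨
      (q.val = n ∧ a = 2 ∧ p.val = n + 1) ∨
      (0 < q.val ∧ q.val < n ∧ a ≠ 2 ∧ p.val = q.val + 1) := by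
  have hq := q.isLt
  have h1 : ((1 : Fin (n + 2)) : ℕ) = 1 := by simp
  have ha := a.isLt
  have e2 : a = 2 ↔ a.val = 2 := by rw [Fin.ext_iff]; rfl
  have e1 : a = 1 ↔ a.val = 1 := by rw [Fin.ext_iff]; rfl
  rw [ne_eq, e1, e2]
  unfold rnδ
  split_ifs <;>
    simp only [Set.mem_singleton_iff, Set.mem_insert_iff, Set.mem_empty_iff_false, Fin.ext_iff, h1] <;>
    first | omega | (rw [false_iff]; omega)

/-- For every `n ≥ 1`, the Büchi language of the NBA `R_n` (initial state `q_0`, accepting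
set `{f}`) equals `L_n^r`. -/
theorem stmt_15 (n : ℕ) (hn : 1 ≤ n) (α : ℕ → Fin 3) :
    (∃ r : ℕ → Fin (n + 2), NBARun (rnδ n) ⟨0, by omega⟩ α r ∧
      {i : ℕ | r i ∈ ({⟨n + 1, by omega⟩} : Set (Fin (n + 2)))}.Infinite) ↔
    α ∈ LnR n := by
  constructor
  · rintro ⟨r, ⟨h0, hr⟩, hinf⟩
    have key : ∀ i, ((r i).val = 0 → ∀ j < i, α j ≠ 2) ∧
        (1 ≤ (r i).val → (r i).val ≤ n →
          (r i).val ≤ i ∧ (∀ j < i, α j ≠ 2) ∧ α (i - (r i).val) = 1) ∧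
        ((r i).val = n + 1 → α ∈ LnR n) := by
      intro i
      induction i with
      | zero => rw [h0]; simp
      | succ i ih =>
        obtain ⟨ih0, ih1, ih2⟩ := ih
        have ext : (∀ j < i, α j ≠ 2) → α i ≠ 2 → ∀ j < i + 1, α j ≠ 2 := by
          intro h h' j hj
          rcases Nat.lt_succ_iff_lt_or_eq.mp hj with h3 | rfl
          · exact h j h3
          · exact h'
        rcases (rn_mem n hn _ _ _).mp (hr i) with ⟨hq, ha, hp | ⟨ha1, hp⟩⟩ | ⟨hq, hp⟩ |
          ⟨hq, ha, hp⟩ | ⟨hq, hq', ha, hp⟩ <;> rw [hp]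
        · exact ⟨fun _ => ext (ih0 hq) ha, by omega, by omega⟩
        · exact ⟨by omega, fun _ _ => ⟨by omega, ext (ih0 hq) ha, by simpa using ha1⟩, by omega⟩
        · exact ⟨by omega, by omega, fun _ => ih2 hq⟩
        · obtain ⟨h1, h2, h3⟩ := ih1 (by omega) (by omega)
          rw [hq] at h1 h3
          exact ⟨by omega, by omega, fun _ => ⟨i, h1, ha, h2, h3⟩⟩
        · obtain ⟨h1, h2, h3⟩ := ih1 (by omega) (by omega)
          refine ⟨by omega, fun _ _ => ⟨by omega, ext h2 ha, ?_⟩, by omega⟩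
          rwa [Nat.add_sub_add_right]
    obtain ⟨i, hi⟩ := hinf.nonempty
    exact (key i).2.2 (by simpa [Fin.ext_iff] using hi)
  · rintro ⟨m, hnm, hm, hlt, h1⟩
    refine ⟨fun i => if i ≤ m - n then ⟨0, by omega⟩ else
      if h : i ≤ m then ⟨i - (m - n), by omega⟩ else ⟨n + 1, by omega⟩, ⟨by simp, ?_⟩, ?_⟩
    · intro i
      rw [rn_mem n hn]
      have hv : ∀ i, ((if i ≤ m - n then ⟨0, by omega⟩ else
        if h : i ≤ m then ⟨i - (m - n), by omega⟩ else ⟨n + 1, by omega⟩ : Fin (n + 2)) : ℕ) =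
        if i ≤ m - n then 0 else if i ≤ m then i - (m - n) else n + 1 := by
        intro i; split_ifs <;> rfl
      simp only [hv]
      rcases lt_trichotomy i (m - n) with h | h | h
      · left
        exact ⟨if_pos (by omega), hlt i (by omega), Or.inl (if_pos (by omega))⟩
      · left
        refine ⟨if_pos (by omega), hlt i (by omega), Or.inr ⟨h ▸ h1, ?_⟩⟩
        rw [if_neg (by omega), if_pos (by omega)]; omega
      · right
        have c1 : ¬ i ≤ m - n := by omega
        have c2 : ¬ i + 1 ≤ m - n := by omega
        rw [if_neg c1, if_neg c2]
        rcases lt_trichotomy i m with h' | h' | h'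
        · have := hlt i h'
          rw [if_pos h'.le, if_pos (show i + 1 ≤ m by omega)]
          right; right
          exact ⟨by omega, by omega, this, by omega⟩
        · rw [if_pos h'.le, if_neg (show ¬ i + 1 ≤ m by omega)]
          right; left
          exact ⟨by omega, h' ▸ hm, rfl⟩
        · rw [if_neg (show ¬ i ≤ m by omega), if_neg (show ¬ i + 1 ≤ m by omega)]
          left; exact ⟨rfl, rfl⟩
    · apply (Set.Ioi_infinite m).mono
      intro i hi
      have hi' : m < i := hi
      simp only [Set.mem_ofPred_eq, Set.mem_singleton_iff]
      rw [if_neg (by omega), dif_neg (by omega)]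
end

section
/- For every n ≥ 1, the NBA R_n is unambiguous: for every ω-word α : ℕ → Fin 3 and any two accepting runs r, r' of R_n on α from the initial state q_0, one has r = r' (every ω-word has at most one accepting run). -/
theorem rn_step (n : ℕ) (hn : 1 ≤ n) (q p : Fin (n + 2)) (a : Fin 3) (h : p ∈ rnδ n q a) :
    (q.val = 0 ∧ a ≠ 2 ∧ (p.val = 0 ∨ p.val = 1)) ∨ (q.val = n + 1 ∧ p.val = n + 1) ∨
    (q.val = n ∧ a = 2 ∧ p.val = n + 1) ∨
    (1 ≤ q.val ∧ q.val < n ∧ a ≠ 2 ∧ p.val = q.val + 1) := by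
  have e1 : (1 : Fin (n + 2)).val = 1 := by simp
  have e2 : a = 2 ↔ a.val = 2 := by rw [Fin.ext_iff]; rfl
  have := q.isLt
  unfold rnδ at h
  rw [Ne, e2]
  split_ifs at h <;>
    simp only [Set.mem_singleton_iff, Set.mem_insert_iff, Set.mem_empty_iff_false,
      Fin.ext_iff, e1] at h <;> omega

theorem rn_shape (n : ℕ) (hn : 1 ≤ n) (α : ℕ → Fin 3) (r : ℕ → Fin (n + 2))
    (q f : Fin (n + 2)) (hq : q.val = 0) (hf0 : f.val = n + 1)
    (h : NBARun (rnδ n) q α r)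
    (hacc : {i : ℕ | r i ∈ ({f} : Set (Fin (n + 2)))}.Infinite) :
    ∃ m, α m = 2 ∧ (∀ j < m, α j ≠ 2) ∧
      ∀ j, (r j).val = if j ≤ m then j + n - m else n + 1 := by
  obtain ⟨h0, hs⟩ := h
  have st := fun i => rn_step n hn _ _ _ (hs i)
  have h0' : (r 0).val = 0 := by rw [h0, hq]
  have hex : ∃ i, (r i).val = n + 1 := by
    obtain ⟨i, hi⟩ := hacc.nonempty
    exact ⟨i, by rw [Set.mem_singleton_iff.1 hi, hf0]⟩
  have hf := Nat.find_spec hex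
  have hmin := fun k => @Nat.find_min _ _ hex k
  generalize Nat.find hex = i at hf hmin
  obtain _ | m := i
  · omega
  have hm := hmin m (by omega)
  have hsm := st m
  have hback : ∀ d, d ≤ m → (r (m - d)).val = n - d := by
    intro d
    induction d with
    | zero => intro _; simp only [Nat.sub_zero]; omega
    | succ d ih =>
      intro hd
      have a1 := ih (by omega)
      have a2 := st (m - (d + 1))
      rw [show m - (d + 1) + 1 = m - d by omega] at a2
      omega
  have hlt : ∀ j, j ≤ m → (r j).val = j + n - m := by
    intro j hj
    have := hback (m - j) (by omega)
    rw [show m - (m - j) = j by omega] at this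
    omega
  have hgt : ∀ d, (r (m + 1 + d)).val = n + 1 := by
    intro d
    induction d with
    | zero => exact hf
    | succ d ih =>
      have := st (m + 1 + d)
      rw [show m + 1 + (d + 1) = m + 1 + d + 1 by omega]
      omega
  refine ⟨m, by omega, ?_, ?_⟩
  · intro j hj
    have a1 := hlt j (by omega)
    have a2 := st j
    rcases a2 with a | a | a | a
    · exact a.2.1
    · omega
    · omega
    · exact a.2.2.1
  · intro j
    split_ifs with hj
    · exact hlt j hj
    · have := hgt (j - (m + 1))
      rwa [show m + 1 + (j - (m + 1)) = j by omega] at this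

/-- For every `n ≥ 1`, the NBA `R_n` is unambiguous: every ω-word has at most one
accepting run from the initial state `q_0`. -/
theorem stmt_16 (n : ℕ) (hn : 1 ≤ n) (α : ℕ → Fin 3) (r r' : ℕ → Fin (n + 2))
    (h : NBARun (rnδ n) ⟨0, by omega⟩ α r)
    (hacc : {i : ℕ | r i ∈ ({⟨n + 1, by omega⟩} : Set (Fin (n + 2)))}.Infinite)
    (h' : NBARun (rnδ n) ⟨0, by omega⟩ α r')
    (hacc' : {i : ℕ | r' i ∈ ({⟨n + 1, by omega⟩} : Set (Fin (n + 2)))}.Infinite) :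
    r = r' := by
  obtain ⟨m, a1, a2, a3⟩ := rn_shape n hn α r _ _ rfl rfl h hacc
  obtain ⟨m', b1, b2, b3⟩ := rn_shape n hn α r' _ _ rfl rfl h' hacc'
  have hmm : m = m' := by
    rcases lt_trichotomy m m' with c | c | c
    · exact absurd a1 (b2 m c)
    · exact c
    · exact absurd b1 (a2 m' c)
  subst hmm
  funext j
  exact Fin.ext ((a3 j).trans (b3 j).symm)
end

section
/- For every n ≥ 1, the Büchi language of the NBA R_n' equals L_n^r: an ω-word α : ℕ → Fin 3 admits an accepting run of R_n' from the initial state q_0 if and only if α ∈ L_n^r. -/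
/-- The transition function of the separating NBA `R_n'`: states are `Fin (n + 2)`, where
`⟨i, _⟩` for `i ≤ n` is the state `q_i` and `⟨n + 1, _⟩` is the state `f`. Letter
`2 : Fin 3` plays the role of the end-marker `$`. Transitions: `δ(q_0,0) = {q_0}`,
`δ(q_0,1) = {q_0,q_1}`, `δ(q_i,σ) = {q_{i+1}}` for `1 ≤ i ≤ n-1` and `σ ∈ {0,1}`,
`δ(q_n,2) = Q` (all states), `δ(f,0) = {f,q_1}`, `δ(f,1) = {f}`, and `∅` in all
remaining cases. The accepting set is `{q_n, f}`. -/
def rnpδ (n : ℕ) (q : Fin (n + 2)) (a : Fin 3) : Set (Fin (n + 2)) :=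
  if h0 : q.val = 0 then
    (if a.val = 0 then {⟨0, by omega⟩}
     else if a.val = 1 then {⟨0, by omega⟩, (1 : Fin (n + 2))}
     else ∅)
  else if hf : q.val = n + 1 then
    (if a.val = 0 then {⟨n + 1, by omega⟩, (1 : Fin (n + 2))}
     else if a.val = 1 then {⟨n + 1, by omega⟩}
     else ∅)
  else if hqn : q.val = n then
    (if a.val = 2 then Set.univ else ∅)
  else
    (if a.val = 2 then ∅ else {⟨q.val + 1, by have := q.isLt; omega⟩})

/-- The accepting set `{q_n, f}` of the NBA `R_n'`. -/
def rnpF (n : ℕ) : Set (Fin (n + 2)) := {⟨n, by omega⟩, ⟨n + 1, by omega⟩}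

theorem rnp_mem (n : ℕ) (hn : 1 ≤ n) (q q' : Fin (n + 2)) (a : Fin 3) :
    q' ∈ rnpδ n q a ↔
      (q.val = 0 ∧ a.val ≠ 2 ∧ (q'.val = 0 ∨ (a.val = 1 ∧ q'.val = 1))) ∨
      (q.val = n + 1 ∧ a.val ≠ 2 ∧ (q'.val = n + 1 ∨ (a.val = 0 ∧ q'.val = 1))) ∨
      (q.val = n ∧ a.val = 2) ∨
      (q.val ≠ 0 ∧ q.val < n ∧ a.val ≠ 2 ∧ q'.val = q.val + 1) := by
  have h1 : (1 : Fin (n + 2)).val = 1 := by simp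
  have hq := q.isLt
  have ha := a.isLt
  unfold rnpδ
  split_ifs <;> simp only [Set.mem_insert_iff, Set.mem_singleton_iff, Set.mem_univ,
    Set.mem_empty_iff_false, Fin.ext_iff, h1, true_iff, false_iff] <;> omega

theorem rnp_memF (n : ℕ) (q : Fin (n + 2)) : q ∈ rnpF n ↔ q.val = n ∨ q.val = n + 1 := by
  simp [rnpF, Fin.ext_iff]

open Classical in
noncomputable def rnpRun (n : ℕ) (α : ℕ → Fin 3) (i : ℕ) : Fin (n + 2) :=
  if h : ∃ k, α (i + k) = 2 then
    (if Nat.find h < n then ⟨n - Nat.find h, by omega⟩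
     else if α (i + Nat.find h - n) = 1 then ⟨0, by omega⟩ else ⟨n + 1, by omega⟩)
  else ⟨n + 1, by omega⟩

theorem rnpRun_none (n : ℕ) (α : ℕ → Fin 3) (i : ℕ) (h : ∀ k, α (i + k) ≠ 2) :
    (rnpRun n α i).val = n + 1 := by
  unfold rnpRun
  rw [dif_neg (by simpa using h)]

theorem rnpRun_some (n : ℕ) (α : ℕ → Fin 3) (i k : ℕ) (h : α (i + k) = 2)
    (h' : ∀ j < k, α (i + j) ≠ 2) :
    (rnpRun n α i).val = if k < n then n - k else if α (i + k - n) = 1 then 0 else n + 1 := by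
  classical
  have hex : ∃ k, α (i + k) = 2 := ⟨k, h⟩
  have hf : Nat.find hex = k := by
    rw [Nat.find_eq_iff]
    exact ⟨h, h'⟩
  unfold rnpRun
  rw [dif_pos hex]
  have : ∀ m, Nat.find hex = m → m = k := fun m hm => by omega
  split_ifs <;> simp_all

theorem rnp_next (α : ℕ → Fin 3) (i : ℕ) :
    (∀ k, α (i + k) ≠ 2) ∨ ∃ k, α (i + k) = 2 ∧ ∀ j < k, α (i + j) ≠ 2 := by
  classical
  by_cases hex : ∃ k, α (i + k) = 2
  · exact Or.inr ⟨Nat.find hex, Nat.find_spec hex, fun j hj => Nat.find_min hex hj⟩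
  · exact Or.inl (by simpa using hex)

theorem rnp_bwd (n : ℕ) (hn : 1 ≤ n) (α : ℕ → Fin 3) (h : α ∈ LnR n)
    (q : Fin (n + 2)) (hq : q.val = 0) :
    (∃ r : ℕ → Fin (n + 2), NBARun (rnpδ n) q α r ∧
      {i : ℕ | r i ∈ rnpF n}.Infinite) := by
  obtain ⟨m, hnm, hm2, hlt, h1⟩ := h
  refine ⟨rnpRun n α, ⟨?_, ?_⟩, ?_⟩
  · apply Fin.ext
    rw [rnpRun_some n α 0 m (by simpa using hm2) (by simpa using hlt)]
    rw [hq, if_neg (by omega), Nat.zero_add, if_pos h1]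
  · intro i
    rw [rnp_mem n hn]
    have e2 : ∀ x : Fin 3, x = 2 ↔ x.val = 2 := by decide
    have e1 : ∀ x : Fin 3, x = 1 ↔ x.val = 1 := by decide
    rcases rnp_next α i with hno | ⟨k, hk, hk'⟩
    · have a := rnpRun_none n α i hno
      have b := rnpRun_none n α (i + 1) (fun k => by
        have := hno (1 + k)
        rwa [← add_assoc] at this)
      have c := hno 0
      rw [add_zero, Ne, e2] at c
      omega
    · have a := rnpRun_some n α i k hk hk'
      rcases k with _ | k
      · rw [add_zero, e2] at hk
        rw [if_pos (by omega)] at a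
        omega
      · have b := rnpRun_some n α (i + 1) k (by rw [← hk]; congr 1; omega) (fun j hj => by
          have := hk' (j + 1) (by omega)
          rwa [show i + (j + 1) = i + 1 + j by omega] at this)
        have c := hk' 0 (by omega)
        rw [add_zero, Ne, e2] at c
        rw [show i + 1 + k - n = i + (k + 1) - n by omega] at b
        have hai := (α i).isLt
        by_cases hkn : k + 1 = n
        · simp only [show i + (k + 1) - n = i by omega, e1] at a b
          split_ifs at a b <;> omega
        · split_ifs at a b <;> omega
  · rw [Set.infinite_iff_exists_gt]
    intro N
    rcases rnp_next α (N + 1) with hno | ⟨k, hk, hk'⟩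
    · exact ⟨N + 1, (rnp_memF _ _).2 (Or.inr (rnpRun_none n α _ hno)), by omega⟩
    · refine ⟨N + 1 + k, (rnp_memF _ _).2 (Or.inl ?_), by omega⟩
      rw [rnpRun_some n α (N + 1 + k) 0 hk (by simp)]
      rw [if_pos (by omega)]
      omega

theorem rnp_fwd (n : ℕ) (hn : 1 ≤ n) (α : ℕ → Fin 3) (r : ℕ → Fin (n + 2))
    (h0 : (r 0).val = 0) (hr : ∀ i, r (i + 1) ∈ rnpδ n (r i) (α i))
    (hF : {i : ℕ | r i ∈ rnpF n}.Infinite) : α ∈ LnR n := by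
  classical
  have e2 : ∀ x : Fin 3, x = 2 ↔ x.val = 2 := by decide
  have e1 : ∀ x : Fin 3, x = 1 ↔ x.val = 1 := by decide
  simp only [rnp_mem n hn] at hr
  have hex : ∃ i, (r i).val ≠ 0 := by
    obtain ⟨i, hi⟩ := hF.nonempty
    have := (rnp_memF _ _).1 hi
    exact ⟨i, by omega⟩
  obtain ⟨p, hp⟩ : ∃ p, Nat.find hex = p + 1 := by
    apply Nat.exists_eq_succ_of_ne_zero
    intro h
    have := Nat.find_spec hex
    rw [h] at this
    exact this h0
  have hs := Nat.find_spec hex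
  rw [hp] at hs
  have hz : ∀ j ≤ p, (r j).val = 0 := fun j hj => by
    have := Nat.find_min hex (m := j) (by omega)
    simpa using this
  have hpp := hr p
  have hzp := hz p le_rfl
  have key : ∀ k, k + 1 ≤ n → (r (p + 1 + k)).val = k + 1 ∧ ∀ j < p + 1 + k, α j ≠ 2 := by
    intro k
    induction k with
    | zero =>
      intro _
      refine ⟨by rw [add_zero]; omega, fun j hj => ?_⟩
      have a := hz j (by omega)
      have b := hr j
      rw [Ne, e2]
      omega
    | succ k ih =>
      intro hk
      obtain ⟨i1, i2⟩ := ih (by omega)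
      have b := hr (p + 1 + k)
      refine ⟨by rw [← add_assoc]; omega, fun j hj => ?_⟩
      by_cases hj' : j < p + 1 + k
      · exact i2 j hj'
      · have : j = p + 1 + k := by omega
        rw [Ne, e2, this]
        omega
  obtain ⟨k1, k2⟩ := key (n - 1) (by omega)
  rw [show p + 1 + (n - 1) = p + n by omega] at k1 k2
  refine ⟨p + n, by omega, ?_, k2, ?_⟩
  · have := hr (p + n)
    rw [e2]
    omega
  · rw [Nat.add_sub_cancel, e1]
    omega

/-- For every `n ≥ 1`, the Büchi language of the NBA `R_n'` (initial state `q_0`,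
accepting set `{q_n, f}`) equals `L_n^r`. -/
theorem stmt_17 (n : ℕ) (hn : 1 ≤ n) (α : ℕ → Fin 3) :
    (∃ r : ℕ → Fin (n + 2), NBARun (rnpδ n) ⟨0, by omega⟩ α r ∧
      {i : ℕ | r i ∈ rnpF n}.Infinite) ↔ α ∈ LnR n := by
  constructor
  · rintro ⟨r, ⟨h0, hr⟩, hF⟩
    exact rnp_fwd n hn α r (by rw [h0]) hr hF
  · intro h
    exact rnp_bwd n hn α h _ rfl
end

section
/- For every n ≥ 1, the NBA R_n' is separating: for any two distinct states q ≠ q' of R_n', the set of ω-words admitting an accepting run of R_n' from q and the set of ω-words admitting an accepting run of R_n' from q' are disjoint. -/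
theorem rnp_step (n : ℕ) (q s : Fin (n + 2)) (a : Fin 3) (h : s ∈ rnpδ n q a) :
    (q.val = 0 ∧ a.val = 0 ∧ s.val = 0) ∨ (q.val = 0 ∧ a.val = 1 ∧ (s.val = 0 ∨ s.val = 1)) ∨
    (q.val = n + 1 ∧ a.val = 0 ∧ (s.val = n + 1 ∨ s.val = 1)) ∨
    (q.val = n + 1 ∧ a.val = 1 ∧ s.val = n + 1) ∨
    (q.val = n ∧ a.val = 2) ∨
    (q.val ≠ 0 ∧ q.val < n ∧ a.val ≠ 2 ∧ s.val = q.val + 1) := by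
  have hq := q.isLt
  have ha := a.isLt
  unfold rnpδ at h
  split_ifs at h <;> (try simp only [Set.mem_insert_iff, Set.mem_singleton_iff, Set.mem_empty_iff_false, Fin.ext_iff, Fin.val_one] at h) <;> omega

theorem rnp_start (n : ℕ) (hn : 1 ≤ n) (α : ℕ → Fin 3) (r : ℕ → Fin (n + 2))
    (hr : ∀ i, r (i + 1) ∈ rnpδ n (r i) (α i)) (hF : {i : ℕ | r i ∈ rnpF n}.Infinite)
    (h2 : ∀ i, (α i).val ≠ 2) : (r 0).val = n + 1 := by
  obtain ⟨i, hi⟩ := hF.nonempty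
  have hi' : (r i).val = n + 1 := by
    have h1 := rnp_step n _ _ _ (hr i)
    have h3 := h2 i
    simp [rnpF, Fin.ext_iff] at hi
    omega
  clear hi
  induction i with
  | zero => exact hi'
  | succ k ih =>
    apply ih
    have h1 := rnp_step n _ _ _ (hr k)
    have h3 := h2 k
    omega

/-- For every `n ≥ 1`, the NBA `R_n'` is separating: for distinct states `q ≠ q'`, the set
of ω-words admitting an accepting run of `R_n'` from `q` and the set of ω-words admitting
an accepting run of `R_n'` from `q'` are disjoint. -/
theorem stmt_18 (n : ℕ) (hn : 1 ≤ n) (q q' : Fin (n + 2)) (hqq : q ≠ q') :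
    Disjoint
      {α : ℕ → Fin 3 | ∃ r : ℕ → Fin (n + 2),
        NBARun (rnpδ n) q α r ∧ {i : ℕ | r i ∈ rnpF n}.Infinite}
      {α : ℕ → Fin 3 | ∃ r : ℕ → Fin (n + 2),
        NBARun (rnpδ n) q' α r ∧ {i : ℕ | r i ∈ rnpF n}.Infinite} := by
  rw [Set.disjoint_left]
  rintro α ⟨r, ⟨h0, hr⟩, hF⟩ ⟨r', ⟨h0', hr'⟩, hF'⟩
  have key : ∀ i, (r i).val ≠ (r' i).val := by
    intro i
    induction i with
    | zero =>
      rw [h0, h0']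
      exact fun h => hqq (Fin.ext h)
    | succ k ih =>
      have h1 := rnp_step n _ _ _ (hr k)
      have h2 := rnp_step n _ _ _ (hr' k)
      omega
  have h2 : ∀ i, (α i).val ≠ 2 := by
    intro i
    have h1 := rnp_step n _ _ _ (hr i)
    have h2 := rnp_step n _ _ _ (hr' i)
    have := key i
    omega
  have e1 := rnp_start n hn α r hr hF h2
  have e2 := rnp_start n hn α r' hr' hF' h2
  exact key 0 (e1.trans e2.symm)
end

section
/- Fix n ≥ 1 and parameters σ_1, …, σ_n ∈ {0, 1} (as letters of Fin 3). Let μ be the probability measure on Fin 3 with μ{0} = 1/4, μ{1} = 1/4 and μ{2} = 1/2, and let P be the i.i.d. infinite product probability measure of μ on ℕ → Fin 3 (Measure.infinitePi of the constant family μ). For α : ℕ → Fin 3 define β_α : ℕ → Fin 3 by β_α j = σ_{j+1} for j < n and β_α j = α (j − n) for j ≥ n (i.e. β_α is σ_1⋯σ_n followed by α). Then P {α | β_α ∈ L_n^r} = 2^{−(n+1)} + Σ_{i=1}^{n} σ_i · 2^{−i}, where σ_i is interpreted as the real number 0 or 1. -/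
open MeasureTheory

/-- The probability measure `μ` on `Fin 3` with `μ{0} = 1/4`, `μ{1} = 1/4`, `μ{2} = 1/2`. -/
noncomputable def mu : Measure (Fin 3) :=
  (1 / 4 : ENNReal) • Measure.dirac 0 + (1 / 4 : ENNReal) • Measure.dirac 1 +
    (1 / 2 : ENNReal) • Measure.dirac 2

lemma mu_val (S : Finset (Fin 3)) : mu (S : Set (Fin 3)) = ∑ x ∈ S, mu {x} := by
  rw [← sum_measure_singleton]

lemma mu_zero : mu {0} = (2⁻¹ : ENNReal) * 2⁻¹ := by
  rw [← ENNReal.mul_inv (by simp) (by simp)]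
  norm_num [mu, Pi.single_apply]
  decide

lemma mu_one : mu {1} = (2⁻¹ : ENNReal) * 2⁻¹ := by
  rw [← ENNReal.mul_inv (by simp) (by simp)]
  norm_num [mu, Pi.single_apply]
  decide

lemma mu_two : mu {2} = (2⁻¹ : ENNReal) := by
  simp [mu]

lemma box_eq (P : Measure (ℕ → Fin 3))
    (hP : ∀ (k : ℕ) (w : ℕ → Fin 3),
      P {α | ∀ i < k, α i = w i} = ∏ i ∈ Finset.range k, mu {w i})
    (k : ℕ) (S : ℕ → Finset (Fin 3)) :
    P {α | ∀ i < k, α i ∈ S i} = ∏ i ∈ Finset.range k, ∑ x ∈ S i, mu {x} := by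
  rw [Finset.prod_range, Finset.prod_univ_sum]
  have hset : {α : ℕ → Fin 3 | ∀ i < k, α i ∈ S i} =
      ⋃ w ∈ Fintype.piFinset (fun i : Fin k => S i),
        {α | ∀ i < k, α i = (fun j => if h : j < k then w ⟨j, h⟩ else 0) i} := by
    ext α
    simp only [Set.mem_setOf_eq, Set.mem_iUnion, Fintype.mem_piFinset, exists_prop]
    constructor
    · intro h
      refine ⟨fun i => α i, fun i => h i i.2, fun i hi => by simp [hi]⟩
    · rintro ⟨w, hw, h⟩ i hi
      rw [h i hi]
      simpa [hi] using hw ⟨i, hi⟩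
  rw [hset, measure_biUnion_finset]
  · refine Finset.sum_congr rfl fun w _ => ?_
    rw [hP, Finset.prod_range]
    simp
  · intro w _ w' _ hne
    refine Set.disjoint_left.2 fun α h h' => hne ?_
    funext i
    have h1 := h i i.2
    have h2 := h' i i.2
    simp at h1 h2
    rw [← h1, ← h2]
  · intro w _
    have : {α : ℕ → Fin 3 | ∀ i < k, α i = (fun j => if h : j < k then w ⟨j, h⟩ else 0) i} =
      ⋂ i, ⋂ (_ : i < k), (fun α : ℕ → Fin 3 => α i) ⁻¹'
        {(fun j => if h : j < k then w ⟨j, h⟩ else 0) i} := by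
      ext; simp
    rw [this]
    exact MeasurableSet.iInter fun i => MeasurableSet.iInter fun _ =>
      measurable_pi_apply i (measurableSet_singleton _)

lemma meas_box (k : ℕ) (S : ℕ → Finset (Fin 3)) :
    MeasurableSet {α : ℕ → Fin 3 | ∀ i < k, α i ∈ S i} := by
  have : {α : ℕ → Fin 3 | ∀ i < k, α i ∈ S i} =
      ⋂ i, ⋂ (_ : i < k), (fun α : ℕ → Fin 3 => α i) ⁻¹' (S i : Set (Fin 3)) := by
    ext; simp
  rw [this]
  exact MeasurableSet.iInter fun i => MeasurableSet.iInter fun _ =>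
    measurable_pi_apply i (Finset.measurableSet _)

/-- letters required for first marker at `k` -/
def boxS (n : ℕ) (σ : ℕ → Fin 3) (k : ℕ) (i : ℕ) : Finset (Fin 3) :=
  if i = k then (if k < n ∧ σ k ≠ 1 then ∅ else {2}) else
    if n ≤ k ∧ i = k - n then {1} else {0, 1}

lemma box_lt (n : ℕ) (σ : ℕ → Fin 3) (k : ℕ) (hk : k < n) :
    ∏ i ∈ Finset.range (k + 1), ∑ x ∈ boxS n σ k i, mu {x} =
      if σ k = 1 then (2⁻¹ : ENNReal) ^ (k + 1) else 0 := by
  rw [Finset.prod_range_succ]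
  split_ifs with h
  · rw [pow_succ]
    congr 1
    · rw [Finset.prod_congr rfl (g := fun _ => (2⁻¹ : ENNReal))]
      · simp
      · intro i hi
        have hi' : i ≠ k := (Finset.mem_range.1 hi).ne
        have : ¬ n ≤ k := by omega
        simp [boxS, hi', this, mu_zero, mu_one, ← mul_add, ENNReal.inv_two_add_inv_two]
    · simp [boxS, h, mu_two]
  · simp [boxS, h, hk]

lemma box_ge (n : ℕ) (hn : 1 ≤ n) (σ : ℕ → Fin 3) (k : ℕ) (hk : n ≤ k) :
    ∏ i ∈ Finset.range (k + 1), ∑ x ∈ boxS n σ k i, mu {x} = (2⁻¹ : ENNReal) ^ (k + 2) := by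
  have h : ¬ k < n := by omega
  rw [Finset.prod_range_succ, Finset.prod_congr rfl
    (g := fun i => (2⁻¹ : ENNReal) * if i = k - n then 2⁻¹ else 1)]
  · rw [Finset.prod_mul_distrib, Finset.prod_ite_eq']
    have : k - n < k := by omega
    simp [boxS, h, this, mu_two]
    ring
  · intro i hi
    have hi' : i ≠ k := (Finset.mem_range.1 hi).ne
    by_cases h2 : i = k - n
    · have : k - n ≠ k := h2 ▸ hi'
      simp [boxS, hk, h2, this, mu_one]
    · simp [boxS, hi', h2, mu_zero, mu_one, ← mul_add, ENNReal.inv_two_add_inv_two]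

/-- Fix `n ≥ 1` and parameters `σ_1, …, σ_n ∈ {0, 1}` (given as `σ : Fin n → Fin 3`, so
that `σ i` is the parameter `σ_{i+1}`). Let `P` be the i.i.d. infinite product of `μ` on
`ℕ → Fin 3`, characterised by its values on cylinders:
`P {α | ∀ i < k, α i = w i} = ∏_{i<k} μ {w i}`. For `α : ℕ → Fin 3` let `β_α` be the
ω-word `σ_1 ⋯ σ_n` followed by `α`. Then
`P {α | β_α ∈ L_n^r} = 2^{-(n+1)} + Σ_{i=1}^{n} σ_i · 2^{-i}`,
where `σ_i` is interpreted as the real number `0` or `1`. -/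
theorem stmt_19 (n : ℕ) (hn : 1 ≤ n) (σ : Fin n → Fin 3) (hσ : ∀ i, σ i = 0 ∨ σ i = 1)
    (P : Measure (ℕ → Fin 3)) [IsProbabilityMeasure P]
    (hP : ∀ (k : ℕ) (w : ℕ → Fin 3),
      P {α | ∀ i < k, α i = w i} = ∏ i ∈ Finset.range k, mu {w i}) :
    P {α | (fun j => if h : j < n then σ ⟨j, h⟩ else α (j - n)) ∈ LnR n} =
      ENNReal.ofReal ((1 / 2 : ℝ) ^ (n + 1) +
        ∑ i : Fin n, ((σ i).val : ℝ) * (1 / 2 : ℝ) ^ (i.val + 1)) := by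
  set τ : ℕ → Fin 3 := fun j => if h : j < n then σ ⟨j, h⟩ else 0 with hτ
  have hset : {α : ℕ → Fin 3 | (fun j => if h : j < n then σ ⟨j, h⟩ else α (j - n)) ∈ LnR n} =
      ⋃ k, {α | ∀ i < k + 1, α i ∈ boxS n τ k i} := by
    ext α
    simp only [LnR, Set.mem_setOf_eq, Set.mem_iUnion]
    constructor
    · rintro ⟨m, hm, h2, hlt, h1⟩
      obtain ⟨k, rfl⟩ := Nat.exists_eq_add_of_le hm
      refine ⟨k, fun i hi => ?_⟩
      simp at h2 h1
      unfold boxS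
      split_ifs with a b c
      · exfalso
        apply b.2
        simpa [hτ, b.1] using h1
      · simp [a, h2]
      · have : ¬ k < n := by omega
        simpa [c, this] using h1
      · have := hlt (n + i) (by omega)
        simp at this
        generalize α i = x at *
        fin_cases x <;> simp_all
    · rintro ⟨k, h⟩
      have hk := h k (by omega)
      have hb : ¬ (k < n ∧ τ k ≠ 1) := by
        intro hb
        simp [boxS, hb] at hk
      have hk2 : α k = 2 := by simpa [boxS, hb] using hk
      refine ⟨n + k, by omega, by simpa using hk2, ?_, ?_⟩
      · intro j hj
        split_ifs with hjn
        · rcases hσ ⟨j, hjn⟩ with e | e <;> rw [e] <;> decide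
        · have := h (j - n) (by omega)
          have h3 : j - n ≠ k := by omega
          intro h4
          rw [h4] at this
          unfold boxS at this
          rw [if_neg h3] at this
          split_ifs at this <;> revert this <;> decide
      · simp only [Nat.add_sub_cancel_left]
        split_ifs with hkn
        · have : τ k = 1 := by
            by_contra h5
            exact hb ⟨hkn, h5⟩
          simpa [hτ, hkn] using this
        · have := h (k - n) (by omega)
          have h3 : k - n ≠ k := by omega
          have h4 : n ≤ k := by omega
          simpa [boxS, h3, h4] using this
  have hlast : ∀ k, ∀ α : ℕ → Fin 3, (∀ i < k + 1, α i ∈ boxS n τ k i) →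
      α k = 2 ∧ ∀ i < k, α i ≠ 2 := by
    intro k α h
    constructor
    · have := h k (by omega)
      simp only [boxS, if_true] at this
      split_ifs at this
      · simp at this
      · simpa using this
    · intro i hi h4
      have := h i (by omega)
      rw [h4] at this
      unfold boxS at this
      rw [if_neg hi.ne] at this
      split_ifs at this <;> revert this <;> decide
  rw [hset, measure_iUnion]
  · simp_rw [box_eq P hP]
    rw [← ENNReal.summable.sum_add_tsum_nat_add' (k := n)]
    have e1 : ∀ i, ∏ j ∈ Finset.range (i + n + 1), ∑ x ∈ boxS n τ (i + n) j, mu {x} =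
        (2⁻¹ : ENNReal) ^ (n + 2) * 2⁻¹ ^ i := by
      intro i
      rw [box_ge n hn τ (i + n) (by omega)]
      ring
    simp_rw [e1]
    rw [ENNReal.tsum_mul_left, ENNReal.tsum_geometric, ENNReal.one_sub_inv_two, inv_inv,
      pow_succ, mul_assoc, ENNReal.inv_mul_cancel (by simp) (by simp), mul_one, add_comm,
      Finset.sum_range, ENNReal.ofReal_add (by positivity)
        (Finset.sum_nonneg fun i _ => by positivity),
      ENNReal.ofReal_sum_of_nonneg (fun i _ => by positivity)]
    have hh : ∀ m : ℕ, ENNReal.ofReal ((1 / 2 : ℝ) ^ m) = 2⁻¹ ^ m := by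
      intro m
      rw [ENNReal.ofReal_pow (by norm_num), one_div, ENNReal.ofReal_inv_of_pos (by norm_num)]
      simp
    rw [hh]
    congr 1
    refine Finset.sum_congr rfl fun i _ => ?_
    rw [box_lt n τ i i.2]
    have : τ i = σ i := by simp [hτ]
    rw [this]
    rcases hσ i with e | e <;> simp [e]
    simpa using (hh (i + 1)).symm
  · intro k l hkl
    refine Set.disjoint_left.2 fun α h h' => hkl ?_
    obtain ⟨a, b⟩ := hlast k α h
    obtain ⟨c, d⟩ := hlast l α h'
    rcases lt_trichotomy k l with h | h | h
    · exact absurd a (d _ h)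
    · exact h
    · exact absurd c (b _ h)
  · exact fun k => meas_box _ _
end
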